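/- Entropy of a composition: with F : {-1,1}^k → ℝ, g₁,...,g_k Boolean functions on disjoint blocks, μ a product distribution, f = F(g₁,...,g_k), and η = ⟨E_μ[g₁],...,E_μ[g_k]⟩, the degree-≥1 spectral entropy satisfies H^μ[f^{≥1}] = H^η[F^{≥1}] + ∑_{S≠∅} F̃(S)² · ∑_{i∈S} H^μ[g_i^{≥1}]/Var_μ[g_i]. -/

import Mathlib

open Finset Real

noncomputable section

/-- ±1 encoding of a Boolean. -/
def b2r (b : Bool) : ℝ := if b then 1 else -1

variable {ι : Type*} [Fintype ι] [DecidableEq ι]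

/-- Uniform-distribution Fourier coefficient `f̂(S) = E[f(x) ∏_{i∈S} x_i]`. -/
def coeff (f : (ι → Bool) → ℝ) (S : Finset ι) : ℝ :=
  (∑ x : ι → Bool, f x * ∏ i ∈ S, b2r (x i)) / (Fintype.card (ι → Bool) : ℝ)

/-- Total influence `Inf[f] = ∑_S |S| f̂(S)²`. -/
def totalInf (f : (ι → Bool) → ℝ) : ℝ :=
  ∑ S : Finset ι, (S.card : ℝ) * (coeff f S) ^ 2

/-- Spectral entropy `H[f] = ∑_S f̂(S)² log₂(1/f̂(S)²)`. -/
def specEnt (f : (ι → Bool) → ℝ) : ℝ :=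
  ∑ S : Finset ι, (coeff f S) ^ 2 * Real.logb 2 (1 / (coeff f S) ^ 2)

/-- Variance `Var[f] = ∑_{S ≠ ∅} f̂(S)²`. -/
def fvariance (f : (ι → Bool) → ℝ) : ℝ :=
  ∑ S ∈ (univ : Finset (Finset ι)).erase ∅, (coeff f S) ^ 2

/-- Weight of the point `x` under the product distribution with biases `μ` (`E[x i] = μ i`). -/
def bweight (μ : ι → ℝ) (x : ι → Bool) : ℝ :=
  ∏ i, (if x i then (1 + μ i) / 2 else (1 - μ i) / 2)

/-- Expectation under the μ-biased product distribution. -/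
def bexp (μ : ι → ℝ) (f : (ι → Bool) → ℝ) : ℝ :=
  ∑ x : ι → Bool, bweight μ x * f x

/-- μ-biased Fourier character `φ^μ_S(x) = ∏_{i∈S} (x_i − μ_i)/σ_i`. -/
def bchi (μ : ι → ℝ) (S : Finset ι) (x : ι → Bool) : ℝ :=
  ∏ i ∈ S, (b2r (x i) - μ i) / Real.sqrt (1 - μ i ^ 2)

/-- μ-biased Fourier coefficient `f̃(S) = E_μ[f φ^μ_S]`. -/
def bcoeff (μ : ι → ℝ) (f : (ι → Bool) → ℝ) (S : Finset ι) : ℝ :=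
  bexp μ fun x => f x * bchi μ S x

/-- μ-biased total influence `Inf^μ[f] = ∑_S |S| f̃(S)²`. -/
def bInf (μ : ι → ℝ) (f : (ι → Bool) → ℝ) : ℝ :=
  ∑ S : Finset ι, (S.card : ℝ) * (bcoeff μ f S) ^ 2

/-- μ-biased variance via Fourier coefficients `Var_μ[f] = ∑_{S ≠ ∅} f̃(S)²`. -/
def bVar (μ : ι → ℝ) (f : (ι → Bool) → ℝ) : ℝ :=
  ∑ S ∈ (univ : Finset (Finset ι)).erase ∅, (bcoeff μ f S) ^ 2

/-- Degree-≥1 μ-biased spectral entropy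
`H^μ[f^{≥1}] = ∑_{S≠∅} f̃(S)² log₂(∏_{i∈S} σ_i² / f̃(S)²)`. -/
def bEnt1 (μ : ι → ℝ) (f : (ι → Bool) → ℝ) : ℝ :=
  ∑ S ∈ (univ : Finset (Finset ι)).erase ∅,
    (bcoeff μ f S) ^ 2 * Real.logb 2 ((∏ i ∈ S, (1 - μ i ^ 2)) / (bcoeff μ f S) ^ 2)

/-- Full μ-biased spectral entropy (sum over all `S`). -/
def bEnt (μ : ι → ℝ) (f : (ι → Bool) → ℝ) : ℝ :=
  ∑ S : Finset ι,
    (bcoeff μ f S) ^ 2 * Real.logb 2 ((∏ i ∈ S, (1 - μ i ^ 2)) / (bcoeff μ f S) ^ 2)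

/-- Probabilistic variance under the μ-biased product distribution. -/
def bVarFn (μ : ι → ℝ) (f : (ι → Bool) → ℝ) : ℝ :=
  bexp μ (fun x => (f x - bexp μ f) ^ 2)

/-- All biases lie strictly between −1 and 1. -/
def validBias (μ : ι → ℝ) : Prop := ∀ i, -1 < μ i ∧ μ i < 1

/-- Discrete derivative `D_{x_j} f`. -/
def Dx (j : ι) (f : (ι → Bool) → ℝ) (x : ι → Bool) : ℝ :=
  (f (Function.update x j true) - f (Function.update x j false)) / 2

/-- μ-biased discrete derivative `D_{φ^μ_j} f = σ_j D_{x_j} f`. -/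
def Dphi (μ : ι → ℝ) (j : ι) (f : (ι → Bool) → ℝ) (x : ι → Bool) : ℝ :=
  Real.sqrt (1 - μ j ^ 2) * Dx j f x

set_option linter.unusedSectionVars false

lemma bexp_sum {α : Type*} (s : Finset α) (μ : ι → ℝ) (f : α → (ι → Bool) → ℝ) :
    bexp μ (fun x => ∑ a ∈ s, f a x) = ∑ a ∈ s, bexp μ (f a) := by
  simp only [bexp, mul_sum]
  exact sum_comm

lemma bexp_const_mul (μ : ι → ℝ) (c : ℝ) (f : (ι → Bool) → ℝ) :
    bexp μ (fun x => c * f x) = c * bexp μ f := by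
  simp only [bexp, mul_sum]
  exact sum_congr rfl fun _ _ => by ring

lemma bexp_prod (μ : ι → ℝ) (u : ι → Bool → ℝ) :
    bexp μ (fun x => ∏ i, u i (x i))
      = ∏ i, ((1 + μ i) / 2 * u i true + (1 - μ i) / 2 * u i false) := by
  have h := Finset.prod_univ_sum (fun _ : ι => (univ : Finset Bool))
    (fun i b => (if b then (1 + μ i) / 2 else (1 - μ i) / 2) * u i b)
  simp only [Fintype.piFinset_univ, Fintype.sum_bool, if_true, Bool.false_eq_true, if_false] at h
  rw [h]
  simp only [bexp, bweight, prod_mul_distrib]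

lemma bexp_one (μ : ι → ℝ) : bexp μ (fun _ => 1) = 1 := by
  have h := bexp_prod μ (fun _ _ => 1)
  simp only [prod_const_one] at h
  rw [h]
  exact prod_eq_one fun i _ => by ring

lemma bchi_eq_prod_univ (μ : ι → ℝ) (S : Finset ι) (x : ι → Bool) :
    bchi μ S x = ∏ i, if i ∈ S then (b2r (x i) - μ i) / √(1 - μ i ^ 2) else 1 := by
  simp [bchi, prod_ite_mem]

lemma bchi_empty (μ : ι → ℝ) (x : ι → Bool) : bchi μ ∅ x = 1 := by
  simp [bchi]

lemma bcoeff_empty (μ : ι → ℝ) (f : (ι → Bool) → ℝ) : bcoeff μ f ∅ = bexp μ f := by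
  simp [bcoeff, bchi_empty]

lemma bexp_bchi (μ : ι → ℝ) (S : Finset ι) :
    bexp μ (bchi μ S) = if S = ∅ then 1 else 0 := by
  split_ifs with hS
  · subst hS
    rw [show bchi μ ∅ = fun _ => 1 from funext (bchi_empty μ), bexp_one]
  · obtain ⟨i, hi⟩ := nonempty_iff_ne_empty.mpr hS
    have h := bexp_prod μ fun i b => if i ∈ S then (b2r b - μ i) / √(1 - μ i ^ 2) else 1
    simp only [← bchi_eq_prod_univ] at h
    rw [show bchi μ S = fun x => bchi μ S x from rfl, h]
    refine prod_eq_zero (mem_univ i) ?_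
    simp only [hi, if_true, b2r, Bool.false_eq_true, if_false]
    ring

lemma validBias.one_sub_sq_pos {μ : ι → ℝ} (hμ : validBias μ) (i : ι) : 0 < 1 - μ i ^ 2 := by
  nlinarith [hμ i]

lemma bweight_pos {μ : ι → ℝ} (hμ : validBias μ) (x : ι → Bool) : 0 < bweight μ x := by
  refine prod_pos fun i _ => ?_
  have := hμ i
  split_ifs <;> linarith

lemma bexp_pos {μ : ι → ℝ} (hμ : validBias μ) {f : (ι → Bool) → ℝ} (hf : ∀ x, 0 ≤ f x)
    {x : ι → Bool} (hx : 0 < f x) : 0 < bexp μ f :=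
  sum_pos' (fun y _ => mul_nonneg (bweight_pos hμ y).le (hf y))
    ⟨x, mem_univ x, mul_pos (bweight_pos hμ x) hx⟩

lemma bweight_mul_sum_bchi {μ : ι → ℝ} (hμ : validBias μ) (x y : ι → Bool) :
    bweight μ x * ∑ S : Finset ι, bchi μ S x * bchi μ S y = if x = y then 1 else 0 := by
  have hs : ∑ S : Finset ι, bchi μ S x * bchi μ S y
      = ∏ i, (1 + (b2r (x i) - μ i) / √(1 - μ i ^ 2) * ((b2r (y i) - μ i) / √(1 - μ i ^ 2))) := by
    rw [Finset.prod_one_add, powerset_univ]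
    simp only [bchi, prod_mul_distrib]
  have hi : ∀ i, (if x i then (1 + μ i) / 2 else (1 - μ i) / 2) *
      (1 + (b2r (x i) - μ i) / √(1 - μ i ^ 2) * ((b2r (y i) - μ i) / √(1 - μ i ^ 2)))
        = if x i = y i then 1 else 0 := by
    intro i
    have hpos := hμ.one_sub_sq_pos i
    rw [div_mul_div_comm, Real.mul_self_sqrt hpos.le]
    have := hpos.ne'
    cases x i <;> cases y i <;>
      simp only [b2r, if_true, if_false, Bool.false_eq_true, Bool.true_eq_false] <;>
      field_simp <;> ring
  rw [hs, bweight, ← prod_mul_distrib, prod_congr rfl fun i _ => hi i]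
  split_ifs with h
  · subst h
    simp
  · obtain ⟨i, hne⟩ := Function.ne_iff.mp h
    exact prod_eq_zero (mem_univ i) (if_neg hne)

/-- Fourier inversion for the biased characters. -/
lemma sum_bcoeff_mul_bchi {μ : ι → ℝ} (hμ : validBias μ) (f : (ι → Bool) → ℝ) (y : ι → Bool) :
    ∑ S : Finset ι, bcoeff μ f S * bchi μ S y = f y := by
  simp only [bcoeff, bexp, sum_mul]
  rw [sum_comm]
  calc ∑ x, ∑ S, bweight μ x * (f x * bchi μ S x) * bchi μ S y
      = ∑ x, f x * (bweight μ x * ∑ S : Finset ι, bchi μ S x * bchi μ S y) := by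
        refine sum_congr rfl fun x _ => ?_
        simp only [mul_sum]
        exact sum_congr rfl fun S _ => by ring
    _ = f y := by simp [bweight_mul_sum_bchi hμ]

/-- Parseval's identity for the biased characters. -/
lemma sum_bcoeff_sq {μ : ι → ℝ} (hμ : validBias μ) (f : (ι → Bool) → ℝ) :
    ∑ S : Finset ι, bcoeff μ f S ^ 2 = bexp μ (fun x => f x ^ 2) := by
  have h : (fun x => f x ^ 2)
      = fun x => ∑ S : Finset ι, bcoeff μ f S * (f x * bchi μ S x) := by
    funext x
    nth_rewrite 1 [sq, ← sum_bcoeff_mul_bchi hμ f x, sum_mul]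
    exact sum_congr rfl fun S _ => by ring
  rw [h, bexp_sum]
  refine sum_congr rfl fun S _ => ?_
  rw [bexp_const_mul, sq]
  rfl

lemma b2r_sq (b : Bool) : b2r b ^ 2 = 1 := by
  cases b <;> simp [b2r]

lemma bVar_b2r {μ : ι → ℝ} (hμ : validBias μ) (G : (ι → Bool) → Bool) :
    bVar μ (fun x => b2r (G x)) = 1 - bexp μ (fun x => b2r (G x)) ^ 2 := by
  have h := sum_bcoeff_sq hμ fun x => b2r (G x)
  simp only [b2r_sq, bexp_one] at h
  rw [← add_sum_erase _ _ (mem_univ (∅ : Finset ι)), bcoeff_empty] at h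
  rw [bVar]
  linarith

lemma bexp_b2r_mem_Ioo {μ : ι → ℝ} (hμ : validBias μ) {G : (ι → Bool) → Bool}
    (hG : ∃ x y, G x ≠ G y) :
    -1 < bexp μ (fun x => b2r (G x)) ∧ bexp μ (fun x => b2r (G x)) < 1 := by
  have key : ∀ b : Bool, ∃ x, G x = b := by
    obtain ⟨x, y, h⟩ := hG
    intro b
    by_cases hx : G x = b
    · exact ⟨x, hx⟩
    · refine ⟨y, ?_⟩
      revert h hx
      cases G x <;> cases G y <;> cases b <;> simp
  have h1 : ∀ c : ℝ, bexp μ (fun x => 1 + c * b2r (G x))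
      = 1 + c * bexp μ (fun x => b2r (G x)) := by
    intro c
    calc _ = bexp μ (fun _ => 1) + bexp μ (fun x => c * b2r (G x)) := by
          simp only [bexp, ← sum_add_distrib, mul_add]
      _ = _ := by rw [bexp_one, bexp_const_mul]
  obtain ⟨x, hx⟩ := key true
  obtain ⟨y, hy⟩ := key false
  have hp : 0 < bexp μ (fun x => 1 + 1 * b2r (G x)) :=
    bexp_pos hμ (x := x) (fun z => by cases G z <;> simp [b2r])
      (by simp [hx, b2r])
  have hm : 0 < bexp μ (fun x => 1 + (-1) * b2r (G x)) :=
    bexp_pos hμ (x := y) (fun z => by cases G z <;> simp [b2r])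
      (by simp [hy, b2r])
  rw [h1] at hp hm
  constructor <;> linarith

/-- The marginal of a product of normalised weights is the weight of the single factor. -/
lemma sum_piFinset_prod_mul {α γ : Type*} [Fintype α] [DecidableEq α]
    (s : α → Finset γ) (p : α → γ → ℝ) (hp : ∀ i, ∑ c ∈ s i, p i c = 1) (i₀ : α) (b : γ → ℝ) :
    ∑ t ∈ Fintype.piFinset s, (∏ i, p i (t i)) * b (t i₀) = ∑ c ∈ s i₀, p i₀ c * b c := by
  have h := Finset.prod_univ_sum s fun i c => p i c * if i = i₀ then b c else 1
  simp only [prod_mul_distrib, prod_ite_eq', mem_univ, if_true] at h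
  rw [← h, prod_eq_single i₀]
  · simp
  · intro i _ hi
    simp [hi, hp]
  · simp

section Blocks

variable {α β : Type*} [Fintype α] [DecidableEq α] [Fintype β] [DecidableEq β]

/-- Expectations of products of functions of disjoint blocks factor. -/
lemma bexp_prod_blocks (μ : α × β → ℝ) (u : α → (β → Bool) → ℝ) :
    bexp μ (fun x => ∏ i, u i (fun j => x (i, j)))
      = ∏ i, bexp (fun j => μ (i, j)) (u i) := by
  simp only [bexp]
  rw [Finset.prod_univ_sum, Fintype.piFinset_univ]
  refine Fintype.sum_equiv (Equiv.curry α β Bool) _ _ fun x => ?_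
  simp only [bweight, Fintype.prod_prod_type, prod_mul_distrib]
  rfl

/-- The part of `T` lying in block `i`. -/
def blockPart (T : Finset (α × β)) (i : α) : Finset β := univ.filter fun j => (i, j) ∈ T

lemma mem_blockPart {T : Finset (α × β)} {i : α} {j : β} : j ∈ blockPart T i ↔ (i, j) ∈ T := by
  simp [blockPart]

/-- A set of coordinates amounts to a choice of a set of coordinates in each block. -/
def blockEquiv : Finset (α × β) ≃ (α → Finset β) where
  toFun := blockPart
  invFun t := univ.filter fun p => p.2 ∈ t p.1
  left_inv T := by ext; simp [blockPart]
  right_inv t := by ext; simp [blockPart]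

lemma prod_eq_prod_blockPart (T : Finset (α × β)) (f : α × β → ℝ) :
    ∏ p ∈ T, f p = ∏ i, ∏ j ∈ blockPart T i, f (i, j) := by
  simp only [blockPart, prod_filter]
  rw [← Fintype.prod_prod_type (fun p => if p ∈ T then f p else 1)]
  simp

lemma bchi_eq_prod_blockPart (μ : α × β → ℝ) (T : Finset (α × β)) (x : α × β → Bool) :
    bchi μ T x = ∏ i, bchi (fun j => μ (i, j)) (blockPart T i) (fun j => x (i, j)) :=
  prod_eq_prod_blockPart T _

lemma bexp_prod_blocks_mul_bchi (μ : α × β → ℝ) (u : α → (β → Bool) → ℝ) (T : Finset (α × β)) :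
    bexp μ (fun x => (∏ i, u i (fun j => x (i, j))) * bchi μ T x)
      = ∏ i, bcoeff (fun j => μ (i, j)) (u i) (blockPart T i) := by
  simp only [bchi_eq_prod_blockPart, ← prod_mul_distrib]
  exact bexp_prod_blocks μ fun i z => u i z * bchi (fun j => μ (i, j)) (blockPart T i) z

lemma bcoeff_const_one (μ : ι → ℝ) (S : Finset ι) :
    bcoeff μ (fun _ => 1) S = if S = ∅ then 1 else 0 := by
  simp only [bcoeff, one_mul]
  exact bexp_bchi μ S

lemma bcoeff_sub_bexp_div (μ : ι → ℝ) (f : (ι → Bool) → ℝ) (c : ℝ) (S : Finset ι) :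
    bcoeff μ (fun x => (f x - bexp μ f) / c) S = if S = ∅ then 0 else bcoeff μ f S / c := by
  have h : bcoeff μ (fun x => (f x - bexp μ f) / c) S
      = (bcoeff μ f S - bexp μ f * bcoeff μ (fun _ => 1) S) / c := by
    simp only [bcoeff]
    rw [← bexp_const_mul]
    simp only [bexp, ← sum_sub_distrib, sum_div]
    exact sum_congr rfl fun x _ => by ring
  rw [h, bcoeff_const_one]
  split_ifs with hS
  · subst hS
    simp [bcoeff_empty]
  · simp

lemma bcoeff_single_block (μ : α × β → ℝ) (i₀ : α) (u : (β → Bool) → ℝ) (T : Finset (α × β)) :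
    bcoeff μ (fun x => u (fun j => x (i₀, j))) T
      = ∏ i, if i = i₀ then bcoeff (fun j => μ (i₀, j)) u (blockPart T i₀)
          else if blockPart T i = ∅ then 1 else 0 := by
  have h := bexp_prod_blocks_mul_bchi μ (fun i z => if i = i₀ then u z else 1) T
  simp only [prod_ite_eq', mem_univ, if_true] at h
  rw [bcoeff, h]
  refine prod_congr rfl fun i _ => ?_
  split_ifs with hi
  · subst hi
    rfl
  all_goals simp_all [bcoeff_const_one]

lemma blockPart_map_self (i : α) (t : Finset β) :
    blockPart (t.map (Function.Embedding.sectR i β)) i = t := by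
  ext j
  simp [mem_blockPart]

lemma blockPart_map_of_ne {i i₀ : α} (h : i ≠ i₀) (t : Finset β) :
    blockPart (t.map (Function.Embedding.sectR i₀ β)) i = ∅ := by
  ext j
  simp [mem_blockPart, h.symm]

lemma bcoeff_single_block_map (μ : α × β → ℝ) (i₀ : α) (u : (β → Bool) → ℝ) (t : Finset β) :
    bcoeff μ (fun x => u (fun j => x (i₀, j))) (t.map (Function.Embedding.sectR i₀ β))
      = bcoeff (fun j => μ (i₀, j)) u t := by
  rw [bcoeff_single_block, prod_eq_single i₀]
  · simp [blockPart_map_self]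
  · intro i _ hi
    simp [hi, blockPart_map_of_ne hi]
  · simp

lemma bcoeff_single_block_eq_zero (μ : α × β → ℝ) (i₀ : α) (u : (β → Bool) → ℝ)
    {T : Finset (α × β)} (hT : ∀ t : Finset β, t.map (Function.Embedding.sectR i₀ β) ≠ T) :
    bcoeff μ (fun x => u (fun j => x (i₀, j))) T = 0 := by
  have : ∃ i, i ≠ i₀ ∧ blockPart T i ≠ ∅ := by
    by_contra! h
    refine hT (blockPart T i₀) (blockEquiv.injective (funext fun i => ?_))
    change blockPart _ i = blockPart T i
    by_cases hi : i = i₀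
    · rw [hi, blockPart_map_self]
    · rw [blockPart_map_of_ne hi, h i hi]
  obtain ⟨i, hi, hne⟩ := this
  rw [bcoeff_single_block]
  exact prod_eq_zero (mem_univ i) (by simp [hi, hne])

lemma sum_single_block (μ : α × β → ℝ) (i₀ : α) (u : (β → Bool) → ℝ)
    (w : Finset (α × β) → ℝ → ℝ) :
    ∑ T ∈ (univ : Finset (Finset (α × β))).erase ∅,
        bcoeff μ (fun x => u (fun j => x (i₀, j))) T ^ 2 *
          w T (bcoeff μ (fun x => u (fun j => x (i₀, j))) T)
      = ∑ t ∈ (univ : Finset (Finset β)).erase ∅, bcoeff (fun j => μ (i₀, j)) u t ^ 2 *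
          w (t.map (Function.Embedding.sectR i₀ β)) (bcoeff (fun j => μ (i₀, j)) u t) := by
  symm
  refine sum_of_injOn (fun t => t.map (Function.Embedding.sectR i₀ β))
    (fun s _ t _ h => map_injective _ h) (fun t ht => by simpa using ht) ?_ ?_
  · intro T hT hn
    rw [bcoeff_single_block_eq_zero μ i₀ u fun t ht => hn ⟨t, ?_, ht⟩]
    · simp
    · subst ht
      simpa using hT
  · intro t _
    simp only [bcoeff_single_block_map]

lemma bVar_single_block (μ : α × β → ℝ) (i₀ : α) (u : (β → Bool) → ℝ) :
    bVar μ (fun x => u (fun j => x (i₀, j))) = bVar (fun j => μ (i₀, j)) u := by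
  simpa [bVar] using sum_single_block μ i₀ u fun _ _ => 1

lemma bEnt1_single_block (μ : α × β → ℝ) (i₀ : α) (u : (β → Bool) → ℝ) :
    bEnt1 μ (fun x => u (fun j => x (i₀, j))) = bEnt1 (fun j => μ (i₀, j)) u := by
  simpa only [bEnt1, prod_map, Function.Embedding.sectR_apply] using
    sum_single_block μ i₀ u fun T c => Real.logb 2 ((∏ p ∈ T, (1 - μ p ^ 2)) / c ^ 2)

lemma bexp_single_block (μ : α × β → ℝ) (i₀ : α) (u : (β → Bool) → ℝ) :
    bexp μ (fun x => u (fun j => x (i₀, j))) = bexp (fun j => μ (i₀, j)) u := by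
  simpa [bcoeff_empty] using bcoeff_single_block_map μ i₀ u ∅

/-- The blocks met by a choice of sets of coordinates. -/
def blockSupport (t : α → Finset β) : Finset α := univ.filter fun i => t i ≠ ∅

/-- Fourier coefficients of a composition with functions of disjoint blocks. -/
lemma bcoeff_comp (μ : α × β → ℝ) (F : (α → Bool) → ℝ) (G : α → (β → Bool) → Bool)
    {η : α → ℝ} (hη : validBias η)
    (hG : ∀ i, η i = bexp (fun j => μ (i, j)) (fun z => b2r (G i z))) (T : Finset (α × β)) :
    bcoeff μ (fun x => F (fun i => G i (fun j => x (i, j)))) T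
      = bcoeff η F (blockSupport (blockPart T)) *
        ∏ i ∈ blockSupport (blockPart T),
          bcoeff (fun j => μ (i, j)) (fun z => b2r (G i z)) (blockPart T i) / √(1 - η i ^ 2) := by
  have h : ∀ S : Finset α,
      bexp μ (fun x => bchi η S (fun i => G i (fun j => x (i, j))) * bchi μ T x)
        = ∏ i, if i ∈ S then (if blockPart T i = ∅ then 0 else
            bcoeff (fun j => μ (i, j)) (fun z => b2r (G i z)) (blockPart T i) / √(1 - η i ^ 2))
          else if blockPart T i = ∅ then 1 else 0 := by
    intro S
    have := bexp_prod_blocks_mul_bchi μ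
      (fun i z => if i ∈ S then (b2r (G i z) - η i) / √(1 - η i ^ 2) else 1) T
    simp only [bchi_eq_prod_univ η]
    rw [this]
    refine prod_congr rfl fun i _ => ?_
    by_cases hi : i ∈ S
    · simp only [hi, if_true]
      nth_rewrite 1 [hG i]
      exact bcoeff_sub_bexp_div _ (fun z => b2r (G i z)) _ _
    · simp only [hi, if_false]
      exact bcoeff_const_one _ _
  have hexp : bcoeff μ (fun x => F (fun i => G i (fun j => x (i, j)))) T
      = ∑ S : Finset α, bcoeff η F S *
        bexp μ (fun x => bchi η S (fun i => G i (fun j => x (i, j))) * bchi μ T x) := by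
    simp only [← bexp_const_mul]
    rw [← bexp_sum, bcoeff]
    congr 1
    funext x
    nth_rewrite 1 [← sum_bcoeff_mul_bchi hη F (fun i => G i (fun j => x (i, j))), sum_mul]
    exact sum_congr rfl fun S _ => by ring
  rw [hexp, sum_eq_single (blockSupport (blockPart T))]
  · rw [h, ← prod_subset (subset_univ (blockSupport (blockPart T)))]
    · congr 1
      refine prod_congr rfl fun i hi => ?_
      have : blockPart T i ≠ ∅ := by simpa [blockSupport] using hi
      simp [hi, this]
    · intro i _ hi
      have : blockPart T i = ∅ := by simpa [blockSupport] using hi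
      simp [hi, this]
  · intro S _ hS
    obtain ⟨i, hi⟩ : ∃ i, ¬ (i ∈ S ↔ i ∈ blockSupport (blockPart T)) := by
      by_contra! h'
      exact hS (ext h')
    rw [h, prod_eq_zero (mem_univ i), mul_zero]
    simp only [blockSupport, mem_filter, mem_univ, true_and] at hi
    split_ifs <;> tauto
  · simp

lemma mem_piFinset_iff_blockSupport_eq (S : Finset α) (t : α → Finset β) :
    t ∈ Fintype.piFinset (fun i => if i ∈ S then (univ : Finset (Finset β)).erase ∅ else {∅})
      ↔ blockSupport t = S := by
  rw [Fintype.mem_piFinset, Finset.ext_iff]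
  refine forall_congr' fun i => ?_
  by_cases hi : i ∈ S <;> simp [hi, blockSupport]

lemma sum_erase_empty_eq_sum_blockSupport (φ : (α → Finset β) → ℝ) :
    ∑ T ∈ (univ : Finset (Finset (α × β))).erase ∅, φ (blockPart T)
      = ∑ S ∈ (univ : Finset (Finset α)).erase ∅,
        ∑ t ∈ Fintype.piFinset
          (fun i => if i ∈ S then (univ : Finset (Finset β)).erase ∅ else {∅}), φ t := by
  have hsupp : ∀ T : Finset (α × β), blockSupport (blockPart T) = ∅ ↔ T = ∅ := by
    intro T
    simp [blockSupport, blockPart, Finset.ext_iff]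
  rw [← sum_fiberwise_of_maps_to (t := univ.erase ∅) (g := fun T => blockSupport (blockPart T))
    (fun T hT => by simpa [hsupp] using hT)]
  refine sum_congr rfl fun S hS => sum_equiv blockEquiv (fun T => ?_) fun T _ => rfl
  rw [mem_piFinset_iff_blockSupport_eq]
  simp only [mem_filter, mem_erase, mem_univ, and_true]
  refine ⟨fun h => h.2, fun h => ⟨?_, h⟩⟩
  rintro rfl
  exact (mem_erase.mp hS).1 (h.symm.trans ((hsupp ∅).mpr rfl))

/-- The logarithm of a product coefficient splits when weighted by the coefficient. -/
lemma sq_mul_logb_prod (S : Finset α) (D : ℝ) (c v r : α → ℝ) (hv : ∀ i, 0 < v i)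
    (hr : ∀ i, 0 < r i) :
    (D * ∏ i ∈ S, c i / √(v i)) ^ 2 *
        Real.logb 2 ((∏ i ∈ S, r i) / (D * ∏ i ∈ S, c i / √(v i)) ^ 2)
      = D ^ 2 * ((∏ i ∈ S, c i ^ 2 / v i) *
        (Real.logb 2 ((∏ i ∈ S, v i) / D ^ 2) + ∑ i ∈ S, Real.logb 2 (r i / c i ^ 2))) := by
  have hsq : (D * ∏ i ∈ S, c i / √(v i)) ^ 2 = D ^ 2 * ∏ i ∈ S, c i ^ 2 / v i := by
    rw [mul_pow, ← prod_pow]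
    congr 1
    exact prod_congr rfl fun i _ => by rw [div_pow, Real.sq_sqrt (hv i).le]
  rw [hsq, mul_assoc]
  by_cases hD : D = 0
  · simp [hD]
  by_cases hc : ∃ i ∈ S, c i = 0
  · obtain ⟨i, hi, h0⟩ := hc
    rw [prod_eq_zero hi (by simp [h0] : c i ^ 2 / v i = 0)]
    simp
  push Not at hc
  have hv' : ∏ i ∈ S, v i ≠ 0 := prod_ne_zero_iff.mpr fun i _ => (hv i).ne'
  have hc' : ∏ i ∈ S, c i ^ 2 ≠ 0 := prod_ne_zero_iff.mpr fun i hi => pow_ne_zero 2 (hc i hi)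
  have hr' : ∏ i ∈ S, r i ≠ 0 := prod_ne_zero_iff.mpr fun i _ => (hr i).ne'
  rw [← Real.logb_prod _ _ fun i hi => div_ne_zero (hr i).ne' (pow_ne_zero 2 (hc i hi)),
    prod_div_distrib, prod_div_distrib,
    ← Real.logb_mul (div_ne_zero hv' (pow_ne_zero 2 hD)) (div_ne_zero hr' hc')]
  congr 3
  field_simp

/-- Degree-≥1 spectral entropy of a composition with functions of disjoint blocks. -/
lemma bEnt1_comp {μ : α × β → ℝ} (hμ : validBias μ) (F : (α → Bool) → ℝ)
    (G : α → (β → Bool) → Bool) (hnc : ∀ i, ∃ x y, G i x ≠ G i y) {η : α → ℝ}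
    (hG : ∀ i, η i = bexp (fun j => μ (i, j)) (fun z => b2r (G i z))) :
    bEnt1 μ (fun x => F (fun i => G i (fun j => x (i, j))))
      = bEnt1 η F + ∑ S ∈ (univ : Finset (Finset α)).erase ∅, bcoeff η F S ^ 2 *
          ∑ i ∈ S, bEnt1 (fun j => μ (i, j)) (fun z => b2r (G i z)) /
            bVar (fun j => μ (i, j)) (fun z => b2r (G i z)) := by
  have hμi : ∀ i, validBias fun j => μ (i, j) := fun i j => hμ (i, j)
  have hη : validBias η := fun i => by
    rw [hG]
    exact bexp_b2r_mem_Ioo (hμi i) (hnc i)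
  have hVar : ∀ i, bVar (fun j => μ (i, j)) (fun z => b2r (G i z)) = 1 - η i ^ 2 := fun i => by
    rw [bVar_b2r (hμi i), ← hG]
  set c : α → Finset β → ℝ := fun i => bcoeff (fun j => μ (i, j)) (fun z => b2r (G i z)) with hc
  set b : α → Finset β → ℝ := fun i t =>
    Real.logb 2 ((∏ j ∈ t, (1 - μ (i, j) ^ 2)) / c i t ^ 2) with hb
  set φ : (α → Finset β) → ℝ := fun t => bcoeff η F (blockSupport t) ^ 2 *
    ((∏ i ∈ blockSupport t, c i (t i) ^ 2 / (1 - η i ^ 2)) *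
      (Real.logb 2 ((∏ i ∈ blockSupport t, (1 - η i ^ 2)) / bcoeff η F (blockSupport t) ^ 2)
        + ∑ i ∈ blockSupport t, b i (t i))) with hφ
  have hterm : bEnt1 μ (fun x => F (fun i => G i (fun j => x (i, j))))
      = ∑ T ∈ (univ : Finset (Finset (α × β))).erase ∅, φ (blockPart T) := by
    refine sum_congr rfl fun T _ => ?_
    rw [bcoeff_comp μ F G hη hG T, prod_eq_prod_blockPart,
      ← prod_subset (subset_univ (blockSupport (blockPart T)))]
    · exact sq_mul_logb_prod _ _ (fun i => c i (blockPart T i)) _ _ hη.one_sub_sq_pos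
        fun i => prod_pos fun j _ => hμ.one_sub_sq_pos (i, j)
    · intro i _ hi
      have : blockPart T i = ∅ := by simpa [blockSupport] using hi
      simp [this]
  rw [hterm, sum_erase_empty_eq_sum_blockSupport, bEnt1, ← sum_add_distrib]
  refine sum_congr rfl fun S _ => ?_
  set s : α → Finset (Finset β) := fun i => if i ∈ S then univ.erase ∅ else {∅} with hs
  set q : α → Finset β → ℝ := fun i t => if i ∈ S then c i t ^ 2 / (1 - η i ^ 2) else 1 with hq
  have hsum : ∀ i, ∑ t ∈ s i, q i t = 1 := by
    intro i
    by_cases hi : i ∈ S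
    · simp only [hs, hq, hi, if_true]
      rw [← sum_div, div_eq_one_iff_eq (hη.one_sub_sq_pos i).ne', ← hVar i]
      rfl
    · simp [hs, hq, hi]
  have htot : ∑ t ∈ Fintype.piFinset s, ∏ i, q i (t i) = 1 := by
    rw [← Finset.prod_univ_sum]
    exact prod_eq_one fun i _ => hsum i
  have hφS : ∀ t ∈ Fintype.piFinset s, φ t = bcoeff η F S ^ 2 *
      ((∏ i, q i (t i)) * Real.logb 2 ((∏ i ∈ S, (1 - η i ^ 2)) / bcoeff η F S ^ 2)
        + ∑ i ∈ S, (∏ i, q i (t i)) * b i (t i)) := by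
    intro t ht
    have hS := (mem_piFinset_iff_blockSupport_eq S t).mp ht
    simp only [hφ, hS, hq, prod_ite_mem, univ_inter, mul_add, mul_sum]
  rw [sum_congr rfl hφS, ← mul_sum, sum_add_distrib, ← sum_mul, htot, one_mul, sum_comm, mul_add]
  congr 2
  refine sum_congr rfl fun i hi => ?_
  rw [sum_piFinset_prod_mul s q hsum i (b i), hVar, bEnt1, sum_div]
  simp only [hs, hq, hi, if_true]
  exact sum_congr rfl fun t _ => by ring

end Blocks

/-- Degree-≥1 spectral entropy of a composition. -/
theorem stmt10 {k l : ℕ} (μ : Fin k × Fin l → ℝ) (hμ : validBias μ)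
    (F : (Fin k → Bool) → ℝ) (g : Fin k → ((Fin k × Fin l → Bool) → Bool))
    (hblock : ∀ (i : Fin k) (x y : Fin k × Fin l → Bool),
      (∀ j : Fin l, x (i, j) = y (i, j)) → g i x = g i y)
    (hnc : ∀ i, ∃ x y, g i x ≠ g i y) :
    bEnt1 μ (fun x => F (fun i => g i x))
      = bEnt1 (fun i => bexp μ (fun x => b2r (g i x))) F
        + ∑ S ∈ (Finset.univ : Finset (Finset (Fin k))).erase ∅,
            (bcoeff (fun i => bexp μ (fun x => b2r (g i x))) F S) ^ 2 *
              ∑ i ∈ S, bEnt1 μ (fun x => b2r (g i x)) / bVar μ (fun x => b2r (g i x)) := by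
  let G : Fin k → (Fin l → Bool) → Bool := fun i z => g i fun p => z p.2
  have hg : ∀ i x, g i x = G i (fun j => x (i, j)) := fun i x => hblock i _ _ fun _ => rfl
  simp only [hg, fun i => bEnt1_single_block μ i fun z => b2r (G i z),
    fun i => bVar_single_block μ i fun z => b2r (G i z)]
  refine bEnt1_comp hμ F G (fun i => ?_) fun i => bexp_single_block μ i fun z => b2r (G i z)
  obtain ⟨x, y, h⟩ := hnc i
  rw [hg, hg] at h
  exact ⟨fun j => x (i, j), fun j => y (i, j), h⟩
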